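/- arXiv:alg-geom/9703001 — 2 statements merged into one kernel-verified Lean document; each statement's English description precedes it below -/
import Mathlib

section
/- Let k be a positive integer and u, w, x, z ∈ S_∞ with u ≤_k w, x ≤_k z, and w∘u^{-1} = z∘x^{-1}. Then the map Φ(v) := v∘u^{-1}∘x is an isomorphism of graded posets from [u,w]_k := {v : u ≤_k v ≤_k w} onto [x,z]_k := {v : x ≤_k v ≤_k z}: Φ is a bijection between these sets, for all v, v' ∈ [u,w]_k one has v ≤_k v' if and only if Φ(v) ≤_k Φ(v'), and ℓ(Φ(v)) − ℓ(x) = ℓ(v) − ℓ(u) for all v ∈ [u,w]_k. -/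
/-- `S_∞`: a permutation of the positive integers lies in `S_∞` iff it
fixes all but finitely many integers. -/
def finSupp (w : Equiv.Perm ℕ+) : Prop := {i : ℕ+ | w i ≠ i}.Finite

/-- The length `ℓ(w) = #{(i,j) : i < j and w(i) > w(j)}`. -/
noncomputable def len (w : Equiv.Perm ℕ+) : ℕ :=
  {p : ℕ+ × ℕ+ | p.1 < p.2 ∧ w p.2 < w p.1}.ncard

/-- Cover relation of the `k`-Bruhat order: `w = u∘(a,b)` with `a ≤ k < b`
and `ℓ(w) = ℓ(u) + 1`. -/
def kBruhatCover (k : ℕ) (u w : Equiv.Perm ℕ+) : Prop :=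
  ∃ a b : ℕ+, (a : ℕ) ≤ k ∧ k < (b : ℕ) ∧ w = u * Equiv.swap a b ∧ len w = len u + 1

/-- The `k`-Bruhat order `≤_k`: reflexive–transitive closure of the cover relation. -/
def kBruhatLE (k : ℕ) : Equiv.Perm ℕ+ → Equiv.Perm ℕ+ → Prop :=
  Relation.ReflTransGen (kBruhatCover k)

/-- The set of inversions of a permutation. -/
def inversions (w : Equiv.Perm ℕ+) : Set (ℕ+ × ℕ+) :=
  {p | p.1 < p.2 ∧ w p.2 < w p.1}

theorem mem_inversions {w : Equiv.Perm ℕ+} {i j : ℕ+} :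
    (i, j) ∈ inversions w ↔ i < j ∧ w j < w i := Iff.rfl

theorem finSupp.finite_inversions {w : Equiv.Perm ℕ+} (hw : finSupp w) :
    (inversions w).Finite := by
  obtain ⟨N, hN⟩ := hw.bddAbove
  have hfix : ∀ i, N < i → w i = i := fun i hi => by
    by_contra hne
    exact absurd (hN hne) (not_le.mpr hi)
  refine ((Set.finite_Iic N).biUnion fun i _ => (Set.finite_singleton i).prod
    ((Set.finite_Iio (w i)).preimage w.injective.injOn)).subset ?_
  rintro ⟨i, j⟩ ⟨hij, hw'⟩
  have hi : i ≤ N := by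
    by_contra! hi
    have h1 := hfix i hi
    have h2 := hfix j (hi.trans hij)
    simp only [h1, h2] at hw'
    exact absurd hij hw'.not_gt
  simp only [Set.mem_iUnion]
  exact ⟨i, hi, rfl, hw'⟩

theorem finSupp.mul_swap {w : Equiv.Perm ℕ+} (hw : finSupp w) (a b : ℕ+) :
    finSupp (w * Equiv.swap a b) := by
  refine (hw.union (Set.toFinite {a, b})).subset ?_
  intro i hi
  by_cases ha : i = a
  · exact Or.inr (Or.inl ha)
  by_cases hb : i = b
  · exact Or.inr (Or.inr hb)
  left
  simpa [Equiv.swap_apply_of_ne_of_ne ha hb] using hi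

/-- Apply the transposition `(a,b)` to both entries of a pair, provided this keeps the pair
increasing. -/
def swapPair (a b : ℕ+) (p : ℕ+ × ℕ+) : ℕ+ × ℕ+ :=
  if Equiv.swap a b p.1 < Equiv.swap a b p.2 then (Equiv.swap a b p.1, Equiv.swap a b p.2) else p

theorem swapPair_swapPair (a b : ℕ+) {p : ℕ+ × ℕ+} (hp : p.1 < p.2) :
    swapPair a b (swapPair a b p) = p := by
  by_cases h : Equiv.swap a b p.1 < Equiv.swap a b p.2 <;> simp [swapPair, h, hp]

theorem swapPair_self {a b : ℕ+} (hab : a < b) : swapPair a b (a, b) = (a, b) := by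
  simp [swapPair, hab.not_gt]

theorem injOn_swapPair (a b : ℕ+) (w : Equiv.Perm ℕ+) :
    Set.InjOn (swapPair a b) (inversions w) := fun p hp q hq h => by
  rw [← swapPair_swapPair a b hp.1, h, swapPair_swapPair a b hq.1]

theorem swapPair_mem_inversions {w : Equiv.Perm ℕ+} {a b : ℕ+} (hab : a < b) (hw : w a < w b)
    {p : ℕ+ × ℕ+} (hp : p ∈ inversions w) :
    swapPair a b p ∈ inversions (w * Equiv.swap a b) := by
  obtain ⟨i, j⟩ := p
  rw [mem_inversions] at hp
  simp only [swapPair]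
  split_ifs with h
  · simpa [mem_inversions, h] using hp.2
  · rw [mem_inversions]
    simp only [Equiv.Perm.mul_apply]
    grind

theorem self_mem_inversions_mul_swap {w : Equiv.Perm ℕ+} {a b : ℕ+} (hab : a < b)
    (hw : w a < w b) : (a, b) ∈ inversions (w * Equiv.swap a b) := by
  simp [mem_inversions, hab, hw]

theorem insert_image_swapPair_subset {w : Equiv.Perm ℕ+} {a b : ℕ+} (hab : a < b)
    (hw : w a < w b) :
    insert (a, b) (swapPair a b '' inversions w) ⊆ inversions (w * Equiv.swap a b) := by
  rintro p (rfl | ⟨q, hq, rfl⟩)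
  · exact self_mem_inversions_mul_swap hab hw
  · exact swapPair_mem_inversions hab hw hq

theorem mem_image_swapPair_iff {w : Equiv.Perm ℕ+} {a b : ℕ+} {p : ℕ+ × ℕ+} (hp : p.1 < p.2) :
    p ∈ swapPair a b '' inversions w ↔ swapPair a b p ∈ inversions w := by
  constructor
  · rintro ⟨q, hq, rfl⟩
    rwa [swapPair_swapPair a b hq.1]
  · exact fun h => ⟨_, h, swapPair_swapPair a b hp⟩

theorem ncard_insert_image_swapPair {w : Equiv.Perm ℕ+} (hw : finSupp w) {a b : ℕ+} (hab : a < b)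
    (hwab : w a < w b) : (insert (a, b) (swapPair a b '' inversions w)).ncard = len w + 1 := by
  rw [Set.ncard_insert_of_notMem _ (hw.finite_inversions.image _),
    (injOn_swapPair a b w).ncard_image]
  · rfl
  · rw [mem_image_swapPair_iff hab, swapPair_self hab]
    exact fun h => hwab.not_gt h.2

theorem len_lt_len_mul_swap {w : Equiv.Perm ℕ+} (hw : finSupp w) {a b : ℕ+} (hab : a < b)
    (hwab : w a < w b) : len w < len (w * Equiv.swap a b) := by
  rw [Nat.lt_iff_add_one_le, ← ncard_insert_image_swapPair hw hab hwab]
  exact Set.ncard_le_ncard (insert_image_swapPair_subset hab hwab)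
    (hw.mul_swap a b).finite_inversions

/-- Multiplying `w` on the right by `(a,b)` raises the length by one iff `w a < w b` and no
position strictly between `a` and `b` has its value strictly between `w a` and `w b`. -/
theorem len_mul_swap_eq_add_one_iff {w : Equiv.Perm ℕ+} (hw : finSupp w) {a b : ℕ+}
    (hab : a < b) :
    len (w * Equiv.swap a b) = len w + 1 ↔
      w a < w b ∧ ∀ c, a < c → c < b → w a < w c → ¬ w c < w b := by
  constructor
  · intro h
    have hwab : w a < w b := by
      by_contra! hle
      have hlt : w b < w a := hle.lt_of_ne (w.injective.ne hab.ne')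
      have := len_lt_len_mul_swap (hw.mul_swap a b) hab (by simpa using hlt)
      rw [mul_assoc, Equiv.swap_mul_self, mul_one] at this
      omega
    refine ⟨hwab, fun c hac hcb h1 h2 => ?_⟩
    have heq := Set.eq_of_subset_of_ncard_le (insert_image_swapPair_subset hab hwab)
      (by rw [ncard_insert_image_swapPair hw hab hwab]; exact h.le)
      (hw.mul_swap a b).finite_inversions
    have hmem : (a, c) ∈ inversions (w * Equiv.swap a b) := by
      simp [mem_inversions, hac, h2, Equiv.swap_apply_of_ne_of_ne hac.ne' hcb.ne]
    rw [← heq, Set.mem_insert_iff, mem_image_swapPair_iff hac] at hmem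
    rcases hmem with hmem | hmem
    · exact hcb.ne (Prod.ext_iff.mp hmem).2
    · have hfix : swapPair a b (a, c) = (a, c) := by
        simp [swapPair, Equiv.swap_apply_of_ne_of_ne hac.ne' hcb.ne, hcb.not_gt]
      rw [hfix] at hmem
      exact h1.not_gt hmem.2
  · rintro ⟨hwab, hc⟩
    rw [← ncard_insert_image_swapPair hw hab hwab]
    refine congrArg Set.ncard (Set.Subset.antisymm ?_ (insert_image_swapPair_subset hab hwab))
    rintro ⟨i, j⟩ hp
    rw [Set.mem_insert_iff, mem_image_swapPair_iff hp.1]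
    replace hp := mem_inversions.mp hp
    simp only [Equiv.Perm.mul_apply] at hp
    simp only [swapPair]
    split_ifs with h
    · exact Or.inr ⟨h, hp.2⟩
    · rw [mem_inversions]
      have htri : ∀ i j, i = j ∨ w i < w j ∨ w j < w i := fun i j =>
        or_iff_not_imp_left.mpr fun hij => (w.injective.ne hij).lt_or_gt
      have := htri i b
      have := htri j a
      grind

theorem finSupp.of_kBruhatCover {k : ℕ} {u w : Equiv.Perm ℕ+} (hu : finSupp u)
    (h : kBruhatCover k u w) : finSupp w := by
  obtain ⟨a, b, -, -, rfl, -⟩ := h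
  exact hu.mul_swap a b

theorem finSupp.of_kBruhatLE {k : ℕ} {u w : Equiv.Perm ℕ+} (hu : finSupp u)
    (h : kBruhatLE k u w) : finSupp w := by
  induction h with
  | refl => exact hu
  | tail _ hc ih => exact ih.of_kBruhatCover hc

/-- A condition on `u` and `w` that is necessary for `u ≤_k w`: values weakly increase at the
positions `≤ k` and weakly decrease at the others, and no pair of positions on the same side of
`k` becomes inverted. -/
structure KBruhatCompat (k : ℕ) (u w : Equiv.Perm ℕ+) : Prop where
  le_of_le : ∀ a : ℕ+, (a : ℕ) ≤ k → u a ≤ w a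
  le_of_lt : ∀ b : ℕ+, k < (b : ℕ) → w b ≤ u b
  lt_of_lt : ∀ i j : ℕ+, i < j → ((j : ℕ) ≤ k ∨ k < (i : ℕ)) → u i < u j → w i < w j

theorem kBruhatLE.compat {k : ℕ} {u w : Equiv.Perm ℕ+} (h : kBruhatLE k u w) (hu : finSupp u) :
    KBruhatCompat k u w := by
  induction h with
  | refl => exact ⟨fun _ _ => le_rfl, fun _ _ => le_rfl, fun _ _ _ _ h => h⟩
  | @tail v w hv hc ih =>
    obtain ⟨a, b, ha, hb, rfl, hlen⟩ := hc
    have hab : a < b := PNat.coe_lt_coe _ _ |>.mp (ha.trans_lt hb)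
    rw [len_mul_swap_eq_add_one_iff (hu.of_kBruhatLE hv) hab] at hlen
    obtain ⟨h1, h2, h3⟩ := ih
    obtain ⟨hlt, hbet⟩ := hlen
    refine ⟨fun i hi => ?_, fun i hi => ?_, fun i j hij hk hlt' => ?_⟩
    · have := h1 i hi
      simp only [Equiv.Perm.mul_apply]
      grind
    · have := h2 i hi
      simp only [Equiv.Perm.mul_apply]
      grind
    · have := h3 i j hij hk hlt'
      have hinj : ∀ i j, v i = v j → i = j := fun _ _ h => v.injective h
      have hbi := hbet i
      have hbj := hbet j
      have e1 : ∀ i j : ℕ+, i < j ↔ (i : ℕ) < j := fun _ _ => Iff.rfl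
      simp only [Equiv.Perm.mul_apply]
      grind

theorem kBruhatCover.mul_right {k : ℕ} {u v w σ : Equiv.Perm ℕ+} (hu : finSupp u)
    (hσ : finSupp (u * σ)) (huv : kBruhatCover k u v) (hvw : KBruhatCompat k v w)
    (huw : KBruhatCompat k u w) (hx : KBruhatCompat k (u * σ) (w * σ)) :
    kBruhatCover k (u * σ) (v * σ) ∧ KBruhatCompat k (v * σ) (w * σ) := by
  obtain ⟨a, b, ha, hb, rfl, hlen⟩ := huv
  have hab : a < b := PNat.coe_lt_coe _ _ |>.mp (ha.trans_lt hb)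
  rw [len_mul_swap_eq_add_one_iff hu hab] at hlen
  obtain ⟨hlt, hbet⟩ := hlen
  obtain ⟨a, rfl⟩ := σ.surjective a
  obtain ⟨b, rfl⟩ := σ.surjective b
  have hmul : u * Equiv.swap (σ a) (σ b) * σ = u * σ * Equiv.swap a b := by
    rw [Equiv.swap_apply_apply]; group
  obtain ⟨v1, v2, v3⟩ := hvw
  obtain ⟨u1, u2, u3⟩ := huw
  obtain ⟨x1, x2, x3⟩ := hx
  have hβ : u (σ b) ≤ w (σ a) := by simpa using v1 _ ha
  have hα : w (σ b) ≤ u (σ a) := by simpa using v2 _ hb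
  simp only [Equiv.Perm.mul_apply] at x1 x2 x3
  have ha' : (a : ℕ) ≤ k := by
    by_contra! h
    exact (hlt.trans_le hβ).not_ge (x2 a h)
  have hb' : k < (b : ℕ) := by
    by_contra! h
    exact (hα.trans_lt hlt).not_ge (x1 b h)
  have hab' : a < b := PNat.coe_lt_coe _ _ |>.mp (ha'.trans_lt hb')
  have hup : ∀ c, u (σ a) < u (σ c) → u (σ c) < u (σ b) → w (σ c) ≤ w (σ a) := by
    intro c h1 h2
    by_contra! h
    have hc : (σ c : ℕ) ≤ k := by
      by_contra! hc
      exact ((h2.trans_le hβ).trans h).not_ge (u2 _ hc)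
    have hcb : σ c < σ b := PNat.coe_lt_coe _ _ |>.mp (hc.trans_lt hb)
    rcases lt_trichotomy (σ c) (σ a) with hca | hca | hca
    · have := v3 _ _ hca (Or.inl ha)
      simp only [Equiv.Perm.mul_apply, Equiv.swap_apply_left,
        Equiv.swap_apply_of_ne_of_ne hca.ne hcb.ne] at this
      exact (this h2).not_gt h
    · rw [hca] at h1; exact h1.false
    · exact hbet _ hca hcb h1 h2
  have hdown : ∀ c, u (σ a) < u (σ c) → u (σ c) < u (σ b) → w (σ b) ≤ w (σ c) := by
    intro c h1 h2
    by_contra! h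
    have hc : k < (σ c : ℕ) := by
      by_contra! hc
      exact ((h.trans_le hα).trans h1).not_ge (u1 _ hc)
    have hac : σ a < σ c := PNat.coe_lt_coe _ _ |>.mp (ha.trans_lt hc)
    rcases lt_trichotomy (σ c) (σ b) with hcb | hcb | hcb
    · exact hbet _ hac hcb h1 h2
    · rw [hcb] at h2; exact h2.false
    · have := v3 _ _ hcb (Or.inr hb)
      simp only [Equiv.Perm.mul_apply, Equiv.swap_apply_right,
        Equiv.swap_apply_of_ne_of_ne hac.ne' hcb.ne'] at this
      exact (this h1).not_gt h
  rw [hmul]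
  refine ⟨⟨a, b, ha', hb', rfl, (len_mul_swap_eq_add_one_iff hσ hab').mpr ⟨hlt, ?_⟩⟩, ?_, ?_, ?_⟩
  · intro c hac hcb h1 h2
    simp only [Equiv.Perm.mul_apply] at h1 h2
    rcases le_or_gt (c : ℕ) k with hc | hc
    · exact (hup c h1 h2).not_gt (x3 _ _ hac (Or.inl hc) h1)
    · exact (hdown c h1 h2).not_gt (x3 _ _ hcb (Or.inr hc) h2)
  · intro i hi
    have := x1 i hi
    simp only [Equiv.Perm.mul_apply]
    grind
  · intro i hi
    have := x2 i hi
    simp only [Equiv.Perm.mul_apply]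
    grind
  · intro i j hij hk hlt'
    have hx := x3 i j hij hk
    have htri := ((u * σ).injective.ne hij.ne).lt_or_gt
    have hne := (w * σ).injective.ne hij.ne
    simp only [Equiv.Perm.mul_apply] at hlt' htri hne ⊢
    have hi := hup i
    have hj := hdown j
    clear v1 v2 v3 u1 u2 u3 x1 x2 x3 hup hdown hmul hbet hu hσ
    grind

theorem kBruhatLE.mul_right {k : ℕ} {u v w σ : Equiv.Perm ℕ+} (hu : finSupp u)
    (hσ : finSupp (u * σ)) (huv : kBruhatLE k u v) (hvw : kBruhatLE k v w)
    (hx : KBruhatCompat k (u * σ) (w * σ)) :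
    kBruhatLE k (u * σ) (v * σ) ∧ KBruhatCompat k (v * σ) (w * σ) ∧
      len (v * σ) + len u = len v + len (u * σ) := by
  induction huv using Relation.ReflTransGen.head_induction_on with
  | refl => exact ⟨.refl, hx, add_comm _ _⟩
  | @head u u' hc huv ih =>
    have hu' := hu.of_kBruhatCover hc
    have hu'w : kBruhatLE k u' w := huv.trans hvw
    obtain ⟨hc', hx'⟩ := hc.mul_right hu hσ (hu'w.compat hu')
      (kBruhatLE.compat (.head hc hu'w) hu) hx
    obtain ⟨h1, h2, h3⟩ := ih hu' (hσ.of_kBruhatCover hc') hx'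
    refine ⟨.head hc' h1, h2, ?_⟩
    obtain ⟨_, _, _, _, _, e⟩ := hc
    obtain ⟨_, _, _, _, _, e'⟩ := hc'
    omega

/-- Right multiplication by `σ` maps `[u,w]_k` into `[uσ,wσ]_k` as soon as `uσ ≤_k wσ`. -/
theorem kBruhatLE.mul_right_mem_interval {k : ℕ} {u v w σ : Equiv.Perm ℕ+} (hu : finSupp u)
    (hσ : finSupp (u * σ)) (hx : kBruhatLE k (u * σ) (w * σ))
    (huv : kBruhatLE k u v) (hvw : kBruhatLE k v w) :
    kBruhatLE k (u * σ) (v * σ) ∧ kBruhatLE k (v * σ) (w * σ) := by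
  obtain ⟨h1, h2, -⟩ := huv.mul_right hu hσ hvw (hx.compat hσ)
  exact ⟨h1, (hvw.mul_right (hu.of_kBruhatLE huv) (hσ.of_kBruhatLE h1) .refl h2).1⟩

/-- Theorem 3.1.2: if `u ≤_k w`, `x ≤_k z` and `w∘u⁻¹ = z∘x⁻¹`, then
`v ↦ v∘u⁻¹∘x` is an isomorphism of graded posets `[u,w]_k ≅ [x,z]_k`. -/
theorem stmt2 (k : ℕ) (hk : 0 < k) (u w x z : Equiv.Perm ℕ+)
    (hu : finSupp u) (hw : finSupp w) (hx : finSupp x) (hz : finSupp z)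
    (huw : kBruhatLE k u w) (hxz : kBruhatLE k x z)
    (h : w * u⁻¹ = z * x⁻¹) :
    Set.BijOn (fun v => v * u⁻¹ * x)
      {v | kBruhatLE k u v ∧ kBruhatLE k v w}
      {v | kBruhatLE k x v ∧ kBruhatLE k v z} ∧
    (∀ v v' : Equiv.Perm ℕ+,
      (kBruhatLE k u v ∧ kBruhatLE k v w) → (kBruhatLE k u v' ∧ kBruhatLE k v' w) →
      (kBruhatLE k v v' ↔ kBruhatLE k (v * u⁻¹ * x) (v' * u⁻¹ * x))) ∧
    (∀ v : Equiv.Perm ℕ+, kBruhatLE k u v → kBruhatLE k v w →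
      (len (v * u⁻¹ * x) : ℤ) - (len x : ℤ) = (len v : ℤ) - (len u : ℤ)) := by
  obtain ⟨σ, rfl⟩ : ∃ σ, x = u * σ := ⟨u⁻¹ * x, by group⟩
  obtain rfl : z = w * σ := by
    rw [eq_mul_inv_iff_mul_eq] at h
    rw [← h]; group
  have hΦ : ∀ v : Equiv.Perm ℕ+, v * u⁻¹ * (u * σ) = v * σ := fun v => by group
  have hσσ : ∀ v : Equiv.Perm ℕ+, v * σ * σ⁻¹ = v := fun v => by group
  simp only [hΦ]
  refine ⟨⟨?_, (mul_left_injective σ).injOn, ?_⟩, ?_, ?_⟩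
  · rintro v ⟨h1, h2⟩
    exact kBruhatLE.mul_right_mem_interval hu hx hxz h1 h2
  · rintro v ⟨h1, h2⟩
    refine ⟨v * σ⁻¹, ?_, by group⟩
    simpa only [hσσ, Set.mem_ofPred_eq] using
      kBruhatLE.mul_right_mem_interval (σ := σ⁻¹) hx (by rwa [hσσ]) (by rwa [hσσ, hσσ]) h1 h2
  · rintro v v' ⟨h1, h2⟩ ⟨h1', h2'⟩
    have hv := kBruhatLE.mul_right_mem_interval hu hx hxz h1 h2
    have hv' := kBruhatLE.mul_right_mem_interval hu hx hxz h1' h2'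
    constructor
    · intro hvv
      exact (kBruhatLE.mul_right_mem_interval (hu.of_kBruhatLE h1) (hx.of_kBruhatLE hv.1) hv.2 hvv h2').1
    · intro hvv
      simpa only [hσσ] using (kBruhatLE.mul_right_mem_interval (σ := σ⁻¹) (hx.of_kBruhatLE hv.1)
        (by rw [hσσ]; exact hu.of_kBruhatLE h1) (by rwa [hσσ, hσσ]) hvv hv'.2).1
  · intro v h1 h2
    have := (kBruhatLE.mul_right hu hx h1 h2 (kBruhatLE.compat hxz hx)).2.2
    omega
end

section
/- Let k be a positive integer and u, w, x, z ∈ S_∞ with u ≤_k w, x ≤_k z, and w∘u^{-1} = z∘x^{-1}. Suppose α < β are positive integers such that (α,β)∘u covers u in the k-Bruhat order and (α,β)∘u ≤_k w, where (α,β) is the transposition of the values α and β. Then (α,β)∘x covers x in the k-Bruhat order and (α,β)∘x ≤_k z. -/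
open Equiv

/-- The set of inversions of a permutation. -/
def invSet (w : Perm ℕ+) : Set (ℕ+ × ℕ+) := {p | p.1 < p.2 ∧ w p.2 < w p.1}

theorem invSet_finite {w : Perm ℕ+} (hw : finSupp w) : (invSet w).Finite := by
  obtain ⟨N, hN⟩ := hw.bddAbove
  have hfix : ∀ i, N < i → w i = i := by
    intro i hi
    by_contra hne
    exact absurd (hN (show i ∈ {i : ℕ+ | w i ≠ i} from hne)) (not_le.2 hi)
  refine ((Set.finite_Iic N).prod (Set.finite_Iic N)).subset ?_
  rintro ⟨p, q⟩ ⟨hpq, hinv⟩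
  simp only at hpq hinv
  have hq : q ≤ N := by
    by_contra! hq
    have hwq := hfix q hq
    have hwp : w (w p) = w p := hfix _ (hq.trans (hwq ▸ hinv))
    rw [hwq, w.injective hwp] at hinv
    exact absurd hpq (not_lt.2 hinv.le)
  exact ⟨hpq.le.trans hq, hq⟩

theorem finSupp.mul {u v : Perm ℕ+} (hu : finSupp u) (hv : finSupp v) : finSupp (u * v) := by
  refine (Set.Finite.union hu hv).subset ?_
  intro i hi
  by_contra hni
  simp only [Set.mem_union, Set.mem_ofPred_eq, not_or, not_not] at hni
  exact hi (by rw [Perm.mul_apply, hni.2, hni.1])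

theorem finSupp_swap (a b : ℕ+) : finSupp (swap a b) := by
  refine (Set.toFinite {a, b}).subset ?_
  intro i hi
  by_contra hni
  simp only [Set.mem_insert_iff, Set.mem_singleton_iff, not_or] at hni
  exact hi (swap_apply_of_ne_of_ne hni.1 hni.2)

/-- Relabel the entries of a pair by the transposition `(a,b)` whenever the result is
increasing. -/
def relabel (a b : ℕ+) (p : ℕ+ × ℕ+) : ℕ+ × ℕ+ :=
  if swap a b p.1 < swap a b p.2 then (swap a b p.1, swap a b p.2) else p

theorem relabel_relabel {a b : ℕ+} {p : ℕ+ × ℕ+} (hp : p.1 < p.2) :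
    relabel a b (relabel a b p) = p := by
  by_cases h : swap a b p.1 < swap a b p.2
  · simp [relabel, h, hp]
  · simp [relabel, h]

theorem relabel_fst_lt {a b : ℕ+} {p : ℕ+ × ℕ+} (hp : p.1 < p.2) :
    (relabel a b p).1 < (relabel a b p).2 := by
  unfold relabel
  split_ifs with h
  · exact h
  · exact hp

theorem mem_relabel_image {a b : ℕ+} {u : Perm ℕ+} {p : ℕ+ × ℕ+} (hp : p.1 < p.2) :
    p ∈ relabel a b '' invSet u ↔ relabel a b p ∈ invSet u := by
  constructor
  · rintro ⟨q, hq, rfl⟩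
    rwa [relabel_relabel hq.1]
  · intro h
    exact ⟨_, h, relabel_relabel hp⟩

/-- The increasing pairs whose order is reversed by `(a,b)`. -/
theorem not_swap_lt_swap {a b p q : ℕ+} (hab : a < b) (hpq : p < q)
    (h : ¬ swap a b p < swap a b q) :
    (p = a ∧ q = b) ∨ (p = a ∧ a < q ∧ q < b) ∨ (q = b ∧ a < p ∧ p < b) := by
  simp only [swap_apply_def] at h
  grind

theorem ncard_relabel_image (a b : ℕ+) (u : Perm ℕ+) :
    (relabel a b '' invSet u).ncard = len u := by
  refine Set.InjOn.ncard_image ?_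
  intro p hp q hq hpq
  rw [← relabel_relabel hp.1 (a := a) (b := b), hpq, relabel_relabel hq.1]

theorem relabel_image_subset {u : Perm ℕ+} {a b : ℕ+} (hab : a < b) (hu : u a < u b) :
    relabel a b '' invSet u ⊆ invSet (u * swap a b) := by
  rintro _ ⟨⟨p, q⟩, ⟨hpq, hinv⟩, rfl⟩
  simp only at hpq hinv
  refine ⟨relabel_fst_lt hpq, ?_⟩
  by_cases h : swap a b p < swap a b q
  · simpa [relabel, h] using hinv
  · simp only [relabel, h, if_false, Perm.mul_apply]
    rcases not_swap_lt_swap hab hpq h with ⟨rfl, rfl⟩ | ⟨rfl, h1, h2⟩ | ⟨rfl, h1, h2⟩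
    · exact absurd hu (not_lt.2 hinv.le)
    · rw [swap_apply_left, swap_apply_of_ne_of_ne h1.ne' h2.ne]
      exact hinv.trans hu
    · rw [swap_apply_right, swap_apply_of_ne_of_ne h1.ne' h2.ne]
      exact hu.trans hinv

theorem mk_left_mem_invSet_mul_swap {u : Perm ℕ+} {a b c : ℕ+} (hac : a < c) (hcb : c ≤ b)
    (hu : u a < u b) (hc : u c < u b ∨ c = b) : (a, c) ∈ invSet (u * swap a b) := by
  refine ⟨hac, ?_⟩
  simp only [Perm.mul_apply, swap_apply_left]
  rcases eq_or_lt_of_le hcb with rfl | hcb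
  · simpa using hu
  · rw [swap_apply_of_ne_of_ne hac.ne' hcb.ne]
    exact hc.resolve_right hcb.ne

theorem mk_left_notMem_relabel_image {u : Perm ℕ+} {a b c : ℕ+} (hac : a < c) (hcb : c ≤ b)
    (hu : u a < u c) : (a, c) ∉ relabel a b '' invSet u := by
  rw [mem_relabel_image hac]
  have h : ¬ swap a b a < swap a b c := by
    rw [swap_apply_left]
    rcases eq_or_lt_of_le hcb with rfl | hcb
    · simpa using hac.le
    · rw [swap_apply_of_ne_of_ne hac.ne' hcb.ne]
      exact not_lt.2 hcb.le
  simp only [relabel, h, if_false]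
  exact fun hm => absurd hu (not_lt.2 hm.2.le)

theorem len_lt_len_mul_swap_s3 {u : Perm ℕ+} (hfin : finSupp u) {a b : ℕ+} (hab : a < b)
    (hu : u a < u b) : len u < len (u * swap a b) := by
  rw [← ncard_relabel_image a b u]
  refine Set.ncard_lt_ncard ?_ (invSet_finite (hfin.mul (finSupp_swap a b)))
  refine (Set.ssubset_iff_of_subset (relabel_image_subset hab hu)).2 ⟨(a, b), ?_, ?_⟩
  · exact mk_left_mem_invSet_mul_swap hab le_rfl hu (Or.inr rfl)
  · exact mk_left_notMem_relabel_image hab le_rfl hu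

theorem len_mul_swap_eq_iff {u : Perm ℕ+} (hfin : finSupp u) {a b : ℕ+} (hab : a < b)
    (hu : u a < u b) :
    len (u * swap a b) = len u + 1 ↔ ∀ c, a < c → c < b → ¬ (u a < u c ∧ u c < u b) := by
  have hfinw := invSet_finite (hfin.mul (finSupp_swap a b))
  have hsub := relabel_image_subset hab hu
  have hmem := mk_left_mem_invSet_mul_swap hab le_rfl hu (Or.inr rfl)
  have hnot := mk_left_notMem_relabel_image hab le_rfl hu
  have hcard : (insert (a, b) (relabel a b '' invSet u)).ncard = len u + 1 := by
    rw [Set.ncard_insert_of_notMem hnot (hfinw.subset hsub), ncard_relabel_image]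
  have hins : insert (a, b) (relabel a b '' invSet u) ⊆ invSet (u * swap a b) :=
    Set.insert_subset hmem hsub
  rw [← hcard]
  constructor
  · rintro h c hac hcb ⟨h1, h2⟩
    have heq := Set.eq_of_subset_of_ncard_le hins h.le hfinw
    have hc := mk_left_mem_invSet_mul_swap hac hcb.le hu (Or.inl h2)
    rw [← heq, Set.mem_insert_iff] at hc
    rcases hc with hc | hc
    · exact hcb.ne (Prod.ext_iff.1 hc).2
    · exact mk_left_notMem_relabel_image hac hcb.le h1 hc
  · intro h
    suffices heq : insert (a, b) (relabel a b '' invSet u) = invSet (u * swap a b) by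
      rw [heq]; rfl
    refine hins.antisymm ?_
    rintro ⟨p, q⟩ ⟨hpq, hinv⟩
    simp only [Perm.mul_apply] at hpq hinv
    rw [Set.mem_insert_iff, mem_relabel_image hpq]
    by_cases hs : swap a b p < swap a b q
    · right
      simp only [relabel, hs, if_true]
      exact ⟨hs, hinv⟩
    · simp only [relabel, hs, if_false]
      rcases not_swap_lt_swap hab hpq hs with ⟨rfl, rfl⟩ | ⟨rfl, h1, h2⟩ | ⟨rfl, h1, h2⟩
      · exact Or.inl rfl
      · right
        rw [swap_apply_left, swap_apply_of_ne_of_ne h1.ne' h2.ne] at hinv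
        refine ⟨hpq, lt_of_not_ge fun hle => ?_⟩
        exact h q h1 h2 ⟨lt_of_le_of_ne hle (u.injective.ne hpq.ne), hinv⟩
      · right
        rw [swap_apply_right, swap_apply_of_ne_of_ne h1.ne' h2.ne] at hinv
        refine ⟨hpq, lt_of_not_ge fun hle => ?_⟩
        exact h p h1 h2 ⟨hinv, lt_of_le_of_ne hle (u.injective.ne hpq.ne)⟩

theorem kBruhatCover_iff {k : ℕ} {u w : Perm ℕ+} (hfin : finSupp u) :
    kBruhatCover k u w ↔ ∃ a b : ℕ+, (a : ℕ) ≤ k ∧ k < (b : ℕ) ∧ w = u * swap a b ∧ u a < u b ∧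
      ∀ c, a < c → c < b → ¬ (u a < u c ∧ u c < u b) := by
  constructor
  · rintro ⟨a, b, ha, hb, rfl, hlen⟩
    have hab : a < b := PNat.coe_lt_coe _ _ |>.1 (ha.trans_lt hb)
    have hu : u a < u b := by
      by_contra! hle
      have hlt : (u * swap a b) a < (u * swap a b) b := by
        simpa using lt_of_le_of_ne hle (u.injective.ne hab.ne')
      have := len_lt_len_mul_swap_s3 (hfin.mul (finSupp_swap a b)) hab hlt
      rw [mul_assoc, swap_mul_self, mul_one] at this
      lia
    exact ⟨a, b, ha, hb, rfl, hu, (len_mul_swap_eq_iff hfin hab hu).1 hlen⟩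
  · rintro ⟨a, b, ha, hb, rfl, hu, hc⟩
    have hab : a < b := PNat.coe_lt_coe _ _ |>.1 (ha.trans_lt hb)
    exact ⟨a, b, ha, hb, rfl, (len_mul_swap_eq_iff hfin hab hu).2 hc⟩

theorem kBruhatCover.finSupp {k : ℕ} {u w : Perm ℕ+} (h : kBruhatCover k u w)
    (hfin : finSupp u) : finSupp w := by
  obtain ⟨a, b, -, -, rfl, -⟩ := h
  exact hfin.mul (finSupp_swap a b)

/-- The non-recursive criterion for comparability in the `k`-Bruhat order. -/
structure KBruhatCriterion (k : ℕ) (u w : Perm ℕ+) : Prop where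
  le_of_le : ∀ a : ℕ+, (a : ℕ) ≤ k → u a ≤ w a
  ge_of_lt : ∀ b : ℕ+, k < (b : ℕ) → w b ≤ u b
  left_mono : ∀ p q : ℕ+, p < q → (q : ℕ) ≤ k → u p < u q → w p < w q
  right_mono : ∀ p q : ℕ+, p < q → k < (p : ℕ) → u p < u q → w p < w q

theorem KBruhatCriterion.trans_cover {k : ℕ} {u v w : Perm ℕ+} (h : KBruhatCriterion k u v)
    (hfin : finSupp v) (hcov : kBruhatCover k v w) : KBruhatCriterion k u w := by
  obtain ⟨a, b, ha, hb, rfl, hv, hc⟩ := (kBruhatCover_iff hfin).1 hcov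
  have hne : ∀ p : ℕ+, (p : ℕ) ≤ k → p ≠ b := by
    rintro p hp rfl
    lia
  have hne' : ∀ p : ℕ+, k < (p : ℕ) → p ≠ a := by
    rintro p hp rfl
    lia
  have hlt : ∀ p q : ℕ+, (p : ℕ) ≤ k → k < (q : ℕ) → p < q := fun p q hp hq =>
    PNat.coe_lt_coe _ _ |>.1 (hp.trans_lt hq)
  constructor
  · intro p hp
    refine (h.le_of_le p hp).trans ?_
    rcases eq_or_ne p a with rfl | hpa
    · simpa using hv.le
    · simp [swap_apply_of_ne_of_ne hpa (hne p hp)]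
  · intro p hp
    refine le_trans ?_ (h.ge_of_lt p hp)
    rcases eq_or_ne p b with rfl | hpb
    · simpa using hv.le
    · simp [swap_apply_of_ne_of_ne (hne' p hp) hpb]
  · intro p q hpq hq hu
    have hvpq := h.left_mono p q hpq hq hu
    have hp : (p : ℕ) ≤ k := (PNat.coe_lt_coe _ _ |>.2 hpq).le.trans hq
    rw [Perm.mul_apply, Perm.mul_apply]
    rcases eq_or_ne q a with rfl | hqa
    · rw [swap_apply_left, swap_apply_of_ne_of_ne hpq.ne (hne p hp)]
      exact hvpq.trans hv
    · rw [swap_apply_of_ne_of_ne hqa (hne q hq)]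
      rcases eq_or_ne p a with rfl | hpa
      · rw [swap_apply_left]
        refine lt_of_not_ge fun hle => hc q hpq (hlt q b hq hb) ⟨hvpq, ?_⟩
        exact lt_of_le_of_ne hle (v.injective.ne (hne q hq))
      · rwa [swap_apply_of_ne_of_ne hpa (hne p hp)]
  · intro p q hpq hp hu
    have hvpq := h.right_mono p q hpq hp hu
    have hq : k < (q : ℕ) := hp.trans (PNat.coe_lt_coe _ _ |>.2 hpq)
    rw [Perm.mul_apply, Perm.mul_apply]
    rcases eq_or_ne p b with rfl | hpb
    · rw [swap_apply_right, swap_apply_of_ne_of_ne (hne' q hq) hpq.ne']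
      exact hv.trans hvpq
    · rw [swap_apply_of_ne_of_ne (hne' p hp) hpb]
      rcases eq_or_ne q b with rfl | hqb
      · rw [swap_apply_right]
        refine lt_of_not_ge fun hle => hc p (hlt a p ha hp) hpq ⟨?_, hvpq⟩
        exact lt_of_le_of_ne hle (v.injective.ne (hne' p hp).symm)
      · rwa [swap_apply_of_ne_of_ne (hne' q hq) hqb]

theorem kBruhatLE.criterion {k : ℕ} {u w : Perm ℕ+} (h : kBruhatLE k u w) (hfin : finSupp u) :
    KBruhatCriterion k u w := by
  suffices finSupp w ∧ KBruhatCriterion k u w from this.2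
  induction h with
  | refl => exact ⟨hfin, ⟨fun _ _ => le_rfl, fun _ _ => le_rfl, fun _ _ _ _ => id,
      fun _ _ _ _ => id⟩⟩
  | tail _ hcov ih => exact ⟨hcov.finSupp ih.1, ih.2.trans_cover ih.1 hcov⟩

/-- A condition on the values `α < β` and on `ζ = w∘u⁻¹` alone which, given `u ≤_k w`, expresses
that `(α,β)∘u` covers `u` and lies below `w`. -/
structure IsAtomPair (ζ : Perm ℕ+) (α β : ℕ+) : Prop where
  lt : α < β
  le_apply : β ≤ ζ α
  apply_le : ζ β ≤ α
  between_left : ∀ γ, α < γ → γ < β → ζ γ < ζ α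
  between_right : ∀ γ, α < γ → γ < β → ζ β < ζ γ

theorem isAtomPair_of_cover {k : ℕ} {u w : Perm ℕ+} (hfin : finSupp u) {α β : ℕ+} (hαβ : α < β)
    (hcov : kBruhatCover k u (swap α β * u)) (hle : kBruhatLE k (swap α β * u) w) :
    IsAtomPair (w * u⁻¹) α β := by
  have hcrit := hle.criterion (hcov.finSupp hfin)
  obtain ⟨a, b, ha, hb, heq, hu, hc⟩ := (kBruhatCover_iff hfin).1 hcov
  have hea : swap α β (u a) = u b := by
    have := Perm.ext_iff.1 heq a
    simpa using this
  obtain ⟨rfl, rfl⟩ : α = u a ∧ β = u b := by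
    simp only [swap_apply_def] at hea
    grind
  rw [heq] at hcrit
  have hne : ∀ p : ℕ+, (p : ℕ) ≤ k → p ≠ b := by
    rintro p hp rfl
    lia
  have hne' : ∀ p : ℕ+, k < (p : ℕ) → p ≠ a := by
    rintro p hp rfl
    lia
  have hlt : ∀ p q : ℕ+, (p : ℕ) ≤ k → k < (q : ℕ) → p < q := fun p q hp hq =>
    PNat.coe_lt_coe _ _ |>.1 (hp.trans_lt hq)
  have hwa : u b ≤ w a := by simpa using hcrit.le_of_le a ha
  have hwb : w b ≤ u a := by simpa using hcrit.ge_of_lt b hb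
  refine ⟨hu, by simpa using hwa, by simpa using hwb, ?_, ?_⟩
  · intro γ h1 h2
    obtain ⟨c, rfl⟩ := u.surjective γ
    simp only [Perm.mul_apply, Perm.inv_def, symm_apply_apply]
    have hca : c ≠ a := by rintro rfl; exact lt_irrefl _ h1
    have hcb : c ≠ b := by rintro rfl; exact lt_irrefl _ h2
    by_contra! hw
    by_cases hck : (c : ℕ) ≤ k
    · have hlt' : c < a := lt_of_le_of_ne
        (le_of_not_gt fun hac => hc c hac (hlt c b hck hb) ⟨h1, h2⟩) hca
      have := hcrit.left_mono c a hlt' ha (by simpa [swap_apply_of_ne_of_ne hca hcb] using h2)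
      exact absurd this (not_lt.2 hw)
    · have := hcrit.ge_of_lt c (not_le.1 hck)
      simp only [Perm.mul_apply, swap_apply_of_ne_of_ne hca hcb] at this
      exact absurd (hwa.trans (hw.trans this)) (not_le.2 h2)
  · intro γ h1 h2
    obtain ⟨c, rfl⟩ := u.surjective γ
    simp only [Perm.mul_apply, Perm.inv_def, symm_apply_apply]
    have hca : c ≠ a := by rintro rfl; exact lt_irrefl _ h1
    have hcb : c ≠ b := by rintro rfl; exact lt_irrefl _ h2
    by_contra! hw
    by_cases hck : (c : ℕ) ≤ k
    · have := hcrit.le_of_le c hck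
      simp only [Perm.mul_apply, swap_apply_of_ne_of_ne hca hcb] at this
      exact absurd (this.trans (hw.trans hwb)) (not_le.2 h1)
    · rw [not_le] at hck
      have hlt' : b < c := lt_of_le_of_ne
        (le_of_not_gt fun hcb => hc c (hlt a c ha hck) hcb ⟨h1, h2⟩) hcb.symm
      have := hcrit.right_mono b c hlt' hb (by simpa [swap_apply_of_ne_of_ne hca hcb] using h1)
      exact absurd this (not_lt.2 hw)

theorem IsAtomPair.cover {k : ℕ} {x z : Perm ℕ+} (hfin : finSupp x)
    (hcrit : KBruhatCriterion k x z) {a b : ℕ+} (h : IsAtomPair (z * x⁻¹) (x a) (x b)) :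
    (a : ℕ) ≤ k ∧ kBruhatCover k x (x * swap a b) ∧ KBruhatCriterion k (x * swap a b) z := by
  obtain ⟨hx, hza, hzb, hl, hr⟩ := h
  simp only [Perm.mul_apply, Perm.inv_def, symm_apply_apply] at hza hzb hl hr
  replace hl : ∀ c, x a < x c → x c < x b → z c < z a := fun c h1 h2 => by
    simpa using hl (x c) h1 h2
  replace hr : ∀ c, x a < x c → x c < x b → z b < z c := fun c h1 h2 => by
    simpa using hr (x c) h1 h2
  have ha : (a : ℕ) ≤ k := by
    by_contra! hak
    exact absurd (hza.trans (hcrit.ge_of_lt a hak)) (not_le.2 hx)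
  have hb : k < (b : ℕ) := by
    by_contra! hbk
    exact absurd ((hcrit.le_of_le b hbk).trans hzb) (not_le.2 hx)
  have hne : ∀ p : ℕ+, (p : ℕ) ≤ k → p ≠ b := by
    rintro p hp rfl
    lia
  have hne' : ∀ p : ℕ+, k < (p : ℕ) → p ≠ a := by
    rintro p hp rfl
    lia
  refine ⟨ha, (kBruhatCover_iff hfin).2 ⟨a, b, ha, hb, rfl, hx, ?_⟩, ?_, ?_, ?_, ?_⟩
  · rintro c hac hcb ⟨h1, h2⟩
    by_cases hck : (c : ℕ) ≤ k
    · exact lt_asymm (hl c h1 h2) (hcrit.left_mono a c hac hck h1)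
    · exact lt_asymm (hr c h1 h2) (hcrit.right_mono c b hcb (not_le.1 hck) h2)
  · intro p hp
    rw [Perm.mul_apply]
    rcases eq_or_ne p a with rfl | hpa
    · simpa using hza
    · simpa [swap_apply_of_ne_of_ne hpa (hne p hp)] using hcrit.le_of_le p hp
  · intro p hp
    rw [Perm.mul_apply]
    rcases eq_or_ne p b with rfl | hpb
    · simpa using hzb
    · simpa [swap_apply_of_ne_of_ne (hne' p hp) hpb] using hcrit.ge_of_lt p hp
  · intro p q hpq hq hu
    have hp : (p : ℕ) ≤ k := (PNat.coe_lt_coe _ _ |>.2 hpq).le.trans hq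
    rw [Perm.mul_apply, Perm.mul_apply] at hu
    rcases eq_or_ne p a with rfl | hpa
    · rw [swap_apply_left, swap_apply_of_ne_of_ne hpq.ne' (hne q hq)] at hu
      exact hcrit.left_mono _ _ hpq hq (hx.trans hu)
    · rw [swap_apply_of_ne_of_ne hpa (hne p hp)] at hu
      rcases eq_or_ne q a with rfl | hqa
      · rw [swap_apply_left] at hu
        rcases lt_or_gt_of_ne (x.injective.ne hpa) with hlt | hgt
        · exact hcrit.left_mono _ _ hpq hq hlt
        · exact hl p hgt hu
      · rw [swap_apply_of_ne_of_ne hqa (hne q hq)] at hu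
        exact hcrit.left_mono _ _ hpq hq hu
  · intro p q hpq hp hu
    have hq : k < (q : ℕ) := hp.trans (PNat.coe_lt_coe _ _ |>.2 hpq)
    rw [Perm.mul_apply, Perm.mul_apply] at hu
    rcases eq_or_ne q b with rfl | hqb
    · rw [swap_apply_right, swap_apply_of_ne_of_ne (hne' p hp) hpq.ne] at hu
      exact hcrit.right_mono _ _ hpq hp (hu.trans hx)
    · rw [swap_apply_of_ne_of_ne (hne' q hq) hqb] at hu
      rcases eq_or_ne p b with rfl | hpb
      · rw [swap_apply_right] at hu
        rcases lt_or_gt_of_ne (x.injective.ne hqb) with hlt | hgt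
        · exact hr q hu hlt
        · exact hcrit.right_mono _ _ hpq hp hgt
      · rw [swap_apply_of_ne_of_ne (hne' p hp) hpb] at hu
        exact hcrit.right_mono _ _ hpq hp hu

theorem eq_one_of_apply_le {ζ : Perm ℕ+} (h : ∀ v, ζ v ≤ v) : ζ = 1 := by
  ext1 v
  induction v using WellFoundedLT.induction with
  | ind v ih =>
    refine le_antisymm (h v) (le_of_not_gt fun hlt => ?_)
    exact hlt.ne (ζ.injective (ih _ hlt))

theorem exists_isAtomPair {ζ : Perm ℕ+} (hζ : ζ ≠ 1) (hfin : {v | v < ζ v}.Finite) :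
    ∃ α β, IsAtomPair ζ α β := by
  have hne : {v | v < ζ v}.Nonempty := by
    by_contra! hem
    refine hζ (eq_one_of_apply_le fun v => le_of_not_gt fun hv => ?_)
    exact (Set.eq_empty_iff_forall_notMem.1 hem) v hv
  obtain ⟨α, hα, hmax⟩ := hfin.exists_maximal hne
  have hdown : ∀ v, α < v → ζ v ≤ v := fun v hv => le_of_not_gt fun h =>
    absurd (hmax h hv.le) (not_le.2 hv)
  have hex : ∃ β, α < β ∧ β ≤ ζ α ∧ ζ β ≤ α := by
    by_contra! hno
    have hmaps : Set.MapsTo ζ (Set.Ioc α (ζ α)) (Set.Ioc α (ζ α)) := fun v hv =>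
      ⟨hno v hv.1 hv.2, (hdown v hv.1).trans hv.2⟩
    have hsurj := (((Set.finite_Ioc α (ζ α)).injOn_iff_bijOn_of_mapsTo hmaps).1
      ζ.injective.injOn).surjOn
    obtain ⟨v, hv, hvα⟩ := hsurj ⟨hα, le_rfl⟩
    exact hv.1.ne' (ζ.injective hvα)
  obtain ⟨⟨α, β⟩, ⟨h1, h2, h3⟩, hmin⟩ := (measure fun p : ℕ+ × ℕ+ => (p.2 : ℕ) - p.1).wf.has_min
    {p | p.1 < p.2 ∧ p.2 ≤ ζ p.1 ∧ ζ p.2 ≤ p.1} (hex.elim fun β hβ => ⟨(α, β), hβ⟩)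
  simp only at h1 h2 h3
  refine ⟨α, β, h1, h2, h3, fun γ hγ hγ' => ?_, fun γ hγ hγ' => ?_⟩
  · refine lt_of_not_ge fun hle => hmin (γ, β) ⟨hγ', h2.trans hle, h3.trans hγ.le⟩ ?_
    have := PNat.coe_lt_coe _ _ |>.2 hγ
    have := PNat.coe_lt_coe _ _ |>.2 hγ'
    change (β : ℕ) - γ < β - α
    lia
  · refine lt_of_not_ge fun hle => hmin (α, γ) ⟨hγ, hγ'.le.trans h2, hle.trans h3⟩ ?_
    have := PNat.coe_lt_coe _ _ |>.2 hγ
    have := PNat.coe_lt_coe _ _ |>.2 hγ'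
    change (γ : ℕ) - α < β - α
    lia

theorem finite_setOf_coe_le (k : ℕ) : {a : ℕ+ | (a : ℕ) ≤ k}.Finite :=
  (Set.finite_Iic k).preimage PNat.coe_injective.injOn

theorem KBruhatCriterion.kBruhatLE {k : ℕ} {x z : Perm ℕ+} (hcrit : KBruhatCriterion k x z)
    (hfin : finSupp x) : kBruhatLE k x z := by
  set S := (finite_setOf_coe_le k).toFinset with hS
  have hmem : ∀ a : ℕ+, a ∈ S ↔ (a : ℕ) ≤ k := by simp [hS]
  induction hn : ∑ a ∈ S, ((z a : ℕ) - x a) using Nat.strong_induction_on generalizing x with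
  | _ n ih =>
    by_cases hxz : z * x⁻¹ = 1
    · rw [mul_inv_eq_one.1 hxz]
      exact Relation.ReflTransGen.refl
    have hup : {v | v < (z * x⁻¹) v}.Finite := by
      refine ((finite_setOf_coe_le k).image x).subset fun v hv => ?_
      obtain ⟨a, rfl⟩ := x.surjective v
      refine ⟨a, ?_, rfl⟩
      by_contra hka
      rw [Set.mem_ofPred_eq, not_le] at hka
      exact absurd (hcrit.ge_of_lt a hka) (not_le.2 (by simpa using hv))
    obtain ⟨α, β, h⟩ := exists_isAtomPair hxz hup
    obtain ⟨a, rfl⟩ := x.surjective α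
    obtain ⟨b, rfl⟩ := x.surjective β
    obtain ⟨ha, hcov, hcrit'⟩ := h.cover hfin hcrit
    refine Relation.ReflTransGen.head hcov (ih _ ?_ hcrit' (hcov.finSupp hfin) rfl)
    have hlt := PNat.coe_lt_coe _ _ |>.2 h.lt
    have hle := PNat.coe_le_coe _ _ |>.2 h.le_apply
    simp only [Perm.mul_apply, Perm.inv_def, symm_apply_apply] at hle
    rw [← hn]
    refine Finset.sum_lt_sum (fun c hc => ?_) ⟨a, (hmem a).2 ha, ?_⟩
    · have h1 := PNat.coe_le_coe _ _ |>.2 (hcrit'.le_of_le c ((hmem c).1 hc))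
      rw [Perm.mul_apply] at h1 ⊢
      rcases eq_or_ne c a with rfl | hca
      · rw [swap_apply_left]
        lia
      rcases eq_or_ne c b with rfl | hcb
      · have h2 := hcrit.le_of_le c ((hmem c).1 hc)
        have h3 := h.apply_le
        simp only [Perm.mul_apply, Perm.inv_def, symm_apply_apply] at h3
        exact absurd (h2.trans h3) (not_le.2 h.lt)
      · rw [swap_apply_of_ne_of_ne hca hcb]
    · rw [Perm.mul_apply, swap_apply_left]
      lia

/-- Lemma 3.1.3: covers transfer along the isomorphism of intervals. -/
theorem stmt3 (k : ℕ) (hk : 0 < k) (u w x z : Equiv.Perm ℕ+)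
    (hu : finSupp u) (hw : finSupp w) (hx : finSupp x) (hz : finSupp z)
    (huw : kBruhatLE k u w) (hxz : kBruhatLE k x z)
    (h : w * u⁻¹ = z * x⁻¹)
    (α β : ℕ+) (hαβ : α < β)
    (hcov : kBruhatCover k u (Equiv.swap α β * u))
    (hle : kBruhatLE k (Equiv.swap α β * u) w) :
    kBruhatCover k x (Equiv.swap α β * x) ∧ kBruhatLE k (Equiv.swap α β * x) z := by
  have hatom := isAtomPair_of_cover hu hαβ hcov hle
  rw [h] at hatom
  obtain ⟨a, rfl⟩ := x.surjective α
  obtain ⟨b, rfl⟩ := x.surjective β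
  obtain ⟨-, hc, hcrit⟩ := hatom.cover hx (hxz.criterion hx)
  rw [← mul_swap_eq_swap_mul]
  exact ⟨hc, hcrit.kBruhatLE (hc.finSupp hx)⟩
end
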